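/- Localized L² bound for a cubic product in ℝ^{2+1}. Let s ∈ (4/7, 1) and let ε > 0 be sufficiently small. There is a constant C = C(s, ε, m₁) such that for every N ≥ 1, every dyadic number M = 2^k (k ∈ ℤ), and all Schwartz functions φ₁, φ₂, φ₃ on ℝ² × ℝ, ‖P_M I_N(φ₁ φ₂ φ₃)‖_{L²_{t,x}(ℝ × ℝ²)} ≤ C ⟨M⟩^{−1} ‖I_N φ₁‖_{X_{1, 1/2+ε}} ‖I_N φ₂‖_{X_{1, 1/2+ε}} ‖I_N φ₃‖_{X_{1, 1/2+ε}}. -/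

import Mathlib

open MeasureTheory Complex Set
open scoped FourierTransform BigOperators RealInnerProductSpace

noncomputable section

abbrev Rn (n : ℕ) := EuclideanSpace ℝ (Fin n)

/-- Japanese bracket of a vector. -/
def jap {n : ℕ} (ξ : Rn n) : ℝ := Real.sqrt (1 + ‖ξ‖ ^ 2)

/-- Japanese bracket of a real number. -/
def japR (x : ℝ) : ℝ := Real.sqrt (1 + x ^ 2)

/-- Inhomogeneous Sobolev norm ‖⟨ξ⟩^s f̂‖_{L²}. -/
def sobNorm (n : ℕ) (s : ℝ) (f : Rn n → ℂ) : ℝ :=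
  (∫ ξ : Rn n, jap ξ ^ (2 * s) * ‖𝓕 f ξ‖ ^ 2) ^ (1/2 : ℝ)

/-- Homogeneous Sobolev norm ‖|ξ|^s f̂‖_{L²}. -/
def sobNormHom (n : ℕ) (s : ℝ) (f : Rn n → ℂ) : ℝ :=
  (∫ ξ : Rn n, ‖ξ‖ ^ (2 * s) * ‖𝓕 f ξ‖ ^ 2) ^ (1/2 : ℝ)

/-- L^p norm on ℝⁿ. -/
def lpNorm (n : ℕ) (p : ℝ) (f : Rn n → ℂ) : ℝ :=
  (∫ x : Rn n, ‖f x‖ ^ p) ^ (1/p)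

/-- Laplacian: sum of second partial derivatives. -/
def laplacian {n : ℕ} (f : Rn n → ℂ) (x : Rn n) : ℂ :=
  ∑ i : Fin n, fderiv ℝ (fun y => fderiv ℝ f y (EuclideanSpace.single i 1)) x
    (EuclideanSpace.single i 1)

/-- Complex gradient as a vector in Euclidean space. -/
def gradC {n : ℕ} (f : Rn n → ℂ) (x : Rn n) : EuclideanSpace ℂ (Fin n) :=
  (WithLp.equiv 2 (Fin n → ℂ)).symm fun i => fderiv ℝ f x (EuclideanSpace.single i 1)

/-- φ is a solution of the cubic defocussing NLS on ℝⁿ × [0,T] with data φ₀: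
smooth, Schwartz in x uniformly for t ∈ [0,T] (with all derivatives),
satisfying i∂ₜφ + Δφ = |φ|²φ and φ(·,0) = φ₀. -/
def IsNLSSolution (n : ℕ) (T : ℝ) (φ : Rn n → ℝ → ℂ) (φ₀ : Rn n → ℂ) : Prop :=
  ContDiff ℝ (⊤ : ℕ∞) (fun p : Rn n × ℝ => φ p.1 p.2) ∧
  (∀ k l : ℕ, ∃ C : ℝ, ∀ t ∈ Icc (0:ℝ) T, ∀ x : Rn n,
      ‖x‖ ^ k * ‖iteratedFDeriv ℝ l (fun y => φ y t) x‖ ≤ C) ∧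
  (∀ x : Rn n, ∀ t ∈ Icc (0:ℝ) T,
      Complex.I * deriv (fun t' => φ x t') t + laplacian (fun y => φ y t) x
        = (‖φ x t‖ : ℂ) ^ 2 * φ x t) ∧
  (∀ x : Rn n, φ x 0 = φ₀ x)

/-- The energy E(f) = ∫ (1/2)|∇f|² + (1/4)|f|⁴. -/
def energy {n : ℕ} (f : Rn n → ℂ) : ℝ :=
  ∫ x : Rn n, ((1/2 : ℝ) * ∑ i : Fin n, ‖fderiv ℝ f x (EuclideanSpace.single i 1)‖ ^ 2
    + (1/4 : ℝ) * ‖f x‖ ^ 4)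

/-- m₁ is a smooth, radially symmetric, nonincreasing multiplier with
m₁ = 1 on the unit ball, m₁(ξ) = |ξ|^{-(1-s)} for |ξ| ≥ 2, 0 < m₁ ≤ 1. -/
def IsAdmissibleMultiplier (n : ℕ) (s : ℝ) (m₁ : Rn n → ℝ) : Prop :=
  ContDiff ℝ (⊤ : ℕ∞) m₁ ∧
  (∀ ξ : Rn n, 0 < m₁ ξ ∧ m₁ ξ ≤ 1) ∧
  (∀ ξ η : Rn n, ‖ξ‖ = ‖η‖ → m₁ ξ = m₁ η) ∧
  (∀ ξ η : Rn n, ‖ξ‖ ≤ ‖η‖ → m₁ η ≤ m₁ ξ) ∧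
  (∀ ξ : Rn n, ‖ξ‖ ≤ 1 → m₁ ξ = 1) ∧
  (∀ ξ : Rn n, 2 ≤ ‖ξ‖ → m₁ ξ = ‖ξ‖ ^ (-(1 - s)))

/-- The rescaled multiplier m_N(ξ) = m₁(ξ/N). -/
def mN {n : ℕ} (m₁ : Rn n → ℝ) (N : ℝ) (ξ : Rn n) : ℝ := m₁ (N⁻¹ • ξ)

/-- The smoothing operator I_N with Fourier multiplier m_N. -/
def Iop {n : ℕ} (m₁ : Rn n → ℝ) (N : ℝ) (f : Rn n → ℂ) : Rn n → ℂ :=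
  fun x => 𝓕⁻ (fun ξ => (mN m₁ N ξ : ℂ) * 𝓕 f ξ) x

/-- The spatial multiplier ⟨∇⟩^s. -/
def japMul (n : ℕ) (s : ℝ) (f : Rn n → ℂ) : Rn n → ℂ :=
  fun x => 𝓕⁻ (fun ξ => ((jap ξ ^ s : ℝ) : ℂ) * 𝓕 f ξ) x

/-- Sharp Littlewood–Paley projection onto {M ≤ ⟨ξ⟩ ≤ 2M}. -/
def LP (n : ℕ) (M : ℝ) (f : Rn n → ℂ) : Rn n → ℂ :=
  fun x => 𝓕⁻ (fun ξ => if M ≤ jap ξ ∧ jap ξ ≤ 2 * M then 𝓕 f ξ else 0) x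

/-- Space-time Fourier transform ψ̃(ξ,τ). -/
def stFourier (n : ℕ) {E : Type*} [NormedAddCommGroup E] [NormedSpace ℂ E]
    (ψ : Rn n → ℝ → E) (ξ : Rn n) (τ : ℝ) : E :=
  ∫ x : Rn n, ∫ t : ℝ,
    Complex.exp (Complex.I * ((-2 * Real.pi * (⟪x, ξ⟫ + t * τ) : ℝ) : ℂ)) • ψ x t

/-- The X_{s,b} norm ‖⟨ξ⟩^s ⟨τ-|ξ|²⟩^b ψ̃‖_{L²}. -/
def XNorm (n : ℕ) {E : Type*} [NormedAddCommGroup E] [NormedSpace ℂ E]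
    (s b : ℝ) (ψ : Rn n → ℝ → E) : ℝ :=
  (∫ ξ : Rn n, ∫ τ : ℝ,
    jap ξ ^ (2 * s) * japR (τ - ‖ξ‖ ^ 2) ^ (2 * b) * ‖stFourier n ψ ξ τ‖ ^ 2) ^ (1/2 : ℝ)

/-- The restricted norm X^δ_{s,b}: infimum over Schwartz extensions off ℝⁿ × [0,δ]. -/
def XRNorm (n : ℕ) {E : Type*} [NormedAddCommGroup E] [NormedSpace ℂ E]
    (s b δ : ℝ) (f : Rn n → ℝ → E) : ℝ :=
  sInf { r : ℝ | ∃ ψ : SchwartzMap (Rn n × ℝ) E,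
    (∀ x : Rn n, ∀ t ∈ Icc (0:ℝ) δ, ψ (x, t) = f x t) ∧
    r = XNorm n s b (fun x t => ψ (x, t)) }

/-- Space-time L^p norm on ℝⁿ × ℝ. -/
def lpNormST (n : ℕ) {E : Type*} [NormedAddCommGroup E] (p : ℝ) (F : Rn n → ℝ → E) : ℝ :=
  (∫ t : ℝ, ∫ x : Rn n, ‖F x t‖ ^ p) ^ (1/p)

/-- Space-time L^p norm on ℝⁿ × [0,δ]. -/
def lpNormSTt (n : ℕ) {E : Type*} [NormedAddCommGroup E] (p δ : ℝ) (F : Rn n → ℝ → E) : ℝ :=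
  (∫ t in Icc (0:ℝ) δ, ∫ x : Rn n, ‖F x t‖ ^ p) ^ (1/p)

lemma japR_rpow (x b : ℝ) : japR x ^ (-2 * b) = (1 + ‖x‖ ^ 2) ^ (-(2 * b) / 2) := by
  rw [japR, Real.sqrt_eq_rpow, ← Real.rpow_mul (by positivity), Real.norm_eq_abs, sq_abs]
  ring_nf

lemma jap_rpow {n : ℕ} (x : Rn n) (r : ℝ) : jap x ^ (-r) = (1 + ‖x‖ ^ 2) ^ (-r / 2) := by
  rw [jap, Real.sqrt_eq_rpow, ← Real.rpow_mul (by positivity)]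
  ring_nf

lemma integrable_japR_rpow {b : ℝ} (hb : 1 / 2 < b) :
    Integrable (fun x : ℝ => japR x ^ (-2 * b)) := by
  simp_rw [japR_rpow]
  exact integrable_rpow_neg_one_add_norm_sq (by simp; linarith)

lemma integrable_jap_rpow {n : ℕ} {r : ℝ} (hr : n < r) :
    Integrable (fun x : Rn n => jap x ^ (-r)) := by
  simp_rw [jap_rpow]
  exact integrable_rpow_neg_one_add_norm_sq (by simpa using hr)

lemma continuous_japR : Continuous japR := by unfold japR; fun_prop

lemma continuous_jap {n : ℕ} : Continuous (jap (n := n)) := by unfold jap; fun_prop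

lemma one_le_japR (x : ℝ) : 1 ≤ japR x := by
  rw [japR, Real.one_le_sqrt]; nlinarith [sq_nonneg x]

lemma one_le_jap {n : ℕ} (x : Rn n) : 1 ≤ jap x := by
  rw [jap, Real.one_le_sqrt]; nlinarith [sq_nonneg ‖x‖]

/-- The planar annuli `{x : 2 ‖x‖ ^ 2 = A + O(1)}` have area bounded uniformly in `A`. -/
lemma integral_annulus_le {b : ℝ} (hb : 1 / 2 < b) (A : ℝ) :
    Integrable (fun x : Rn 2 => japR (A - 2 * ‖x‖ ^ 2) ^ (-2 * b)) ∧
    ∫ x : Rn 2, japR (A - 2 * ‖x‖ ^ 2) ^ (-2 * b) ≤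
      volume.real (Metric.ball (0 : Rn 2) 1) * ∫ y : ℝ, japR y ^ (-2 * b) := by
  have h1 : Integrable (fun y : ℝ => japR (A - 2 * y) ^ (-2 * b)) :=
    ((integrable_japR_rpow hb).comp_sub_left A).comp_mul_left' two_ne_zero
  have key : ∀ y : ℝ, y ^ (Module.finrank ℝ (Rn 2) - 1) • japR (A - 2 * y ^ 2) ^ (-2 * b)
      = (1 / 2 : ℝ) * ((|(2:ℝ)| * y ^ ((2:ℝ) - 1)) • japR (A - 2 * y ^ (2:ℝ)) ^ (-2 * b)) := by
    intro y
    have : (2:ℝ) - 1 = 1 := by norm_num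
    simp [this]
    ring
  constructor
  · refine (integrable_fun_norm_addHaar volume
      (f := fun y => japR (A - 2 * y ^ 2) ^ (-2 * b))).2 ?_
    simp_rw [key]
    exact ((integrableOn_Ioi_comp_rpow_iff (fun y => japR (A - 2 * y) ^ (-2 * b))
      two_ne_zero).2 h1.integrableOn).const_mul _
  · rw [integral_fun_norm_addHaar volume (fun y => japR (A - 2 * y ^ 2) ^ (-2 * b))]
    simp_rw [key]
    rw [integral_const_mul, integral_comp_rpow_Ioi (fun y => japR (A - 2 * y) ^ (-2 * b))
      two_ne_zero]
    have h2 : ∫ y in Ioi (0:ℝ), japR (A - 2 * y) ^ (-2 * b) ≤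
        ∫ y : ℝ, japR (A - 2 * y) ^ (-2 * b) :=
      setIntegral_le_integral h1 (.of_forall fun y => by
        have := one_le_japR (A - 2 * y)
        positivity)
    have h3 : ∫ y : ℝ, japR (A - 2 * y) ^ (-2 * b) = (1 / 2) * ∫ y : ℝ, japR y ^ (-2 * b) := by
      rw [Measure.integral_comp_mul_left (fun y => japR (A - y) ^ (-2 * b)),
        integral_sub_left_eq_self (fun y => japR y ^ (-2 * b))]
      simp
    rw [h3] at h2
    have h4 : 0 ≤ ∫ y : ℝ, japR y ^ (-2 * b) := integral_nonneg fun y => by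
        have := one_le_japR y
        positivity
    have h5 : (0:ℝ) ≤ volume.real (Metric.ball (0 : Rn 2) 1) := by positivity
    simp only [finrank_euclideanSpace, Fintype.card_fin, smul_eq_mul, nsmul_eq_mul]
    push_cast
    nlinarith [mul_le_mul_of_nonneg_left h2 h5, mul_nonneg h5 h4]

lemma exists_lintegral_annulus_le {b : ℝ} (hb : 1 / 2 < b) :
    ∃ C : ENNReal, C ≠ ⊤ ∧ ∀ (A : ℝ) (η : Rn 2),
      ∫⁻ ξ : Rn 2, ENNReal.ofReal (japR (A - ‖ξ‖ ^ 2 - ‖η - ξ‖ ^ 2) ^ (-2 * b)) ≤ C := by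
  refine ⟨ENNReal.ofReal (volume.real (Metric.ball (0 : Rn 2) 1) * ∫ y : ℝ, japR y ^ (-2 * b)),
    ENNReal.ofReal_ne_top, fun A η => ?_⟩
  obtain ⟨h1, h2⟩ := integral_annulus_le hb (A - ‖η‖ ^ 2 / 2)
  have h3 : ∀ ξ : Rn 2, A - ‖ξ‖ ^ 2 - ‖η - ξ‖ ^ 2 =
      A - ‖η‖ ^ 2 / 2 - 2 * ‖ξ - (1 / 2 : ℝ) • η‖ ^ 2 := by
    intro ξ
    rw [norm_sub_sq_real, norm_sub_sq_real, norm_smul, inner_smul_right, real_inner_comm]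
    norm_num
    ring
  simp_rw [h3]
  rw [lintegral_sub_right_eq_self
    (fun ξ : Rn 2 => ENNReal.ofReal (japR (A - ‖η‖ ^ 2 / 2 - 2 * ‖ξ‖ ^ 2) ^ (-2 * b)))]
  rw [← ofReal_integral_eq_lintegral_ofReal h1 (.of_forall fun y => by
    have := one_le_japR (A - ‖η‖ ^ 2 / 2 - 2 * ‖y‖ ^ 2)
    positivity)]
  exact ENNReal.ofReal_le_ofReal h2

/-- The weight `⟨τ - |ξ|²⟩^{-2b}` on space-time frequencies. -/
def parabWeight (b : ℝ) (p : Rn 2 × ℝ) : ENNReal :=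
  ENNReal.ofReal (japR (p.2 - ‖p.1‖ ^ 2) ^ (-2 * b))

lemma measurable_parabWeight (b : ℝ) : Measurable (parabWeight b) := by
  unfold parabWeight
  have := continuous_japR.measurable
  fun_prop

lemma lintegral_parabWeight_fiber (b : ℝ) (ξ : Rn 2) :
    ∫⁻ τ : ℝ, parabWeight b (ξ, τ) = ∫⁻ τ : ℝ, ENNReal.ofReal (japR τ ^ (-2 * b)) := by
  simp only [parabWeight]
  exact lintegral_sub_right_eq_self (fun τ : ℝ => ENNReal.ofReal (japR τ ^ (-2 * b))) (‖ξ‖ ^ 2)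

lemma lintegral_japR_rpow_ne_top {b : ℝ} (hb : 1 / 2 < b) :
    ∫⁻ τ : ℝ, ENNReal.ofReal (japR τ ^ (-2 * b)) ≠ ⊤ :=
  (integrable_japR_rpow hb).lintegral_lt_top.ne

/-- The self-convolution of the weight is bounded: this is the `L⁴` Strichartz estimate. -/
lemma exists_parabWeight_convolution_le {b : ℝ} (hb : 1 / 2 < b) :
    ∃ C : ENNReal, C ≠ ⊤ ∧ ∀ ζ : Rn 2 × ℝ,
      ∫⁻ p, parabWeight b (ζ - p) * parabWeight b p ≤ C := by
  obtain ⟨C, hC, h⟩ := exists_lintegral_annulus_le hb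
  refine ⟨C * ∫⁻ τ : ℝ, ENNReal.ofReal (japR τ ^ (-2 * b)),
    ENNReal.mul_ne_top hC (lintegral_japR_rpow_ne_top hb), fun ζ => ?_⟩
  have hm := measurable_parabWeight b
  have hj := continuous_japR.measurable
  have e1 : ∀ ξ : Rn 2, ∫⁻ τ : ℝ, parabWeight b (ζ - (ξ, τ)) * parabWeight b (ξ, τ) =
      ∫⁻ τ : ℝ, ENNReal.ofReal (japR (ζ.2 - τ - ‖ξ‖ ^ 2 - ‖ζ.1 - ξ‖ ^ 2) ^ (-2 * b)) *
        ENNReal.ofReal (japR τ ^ (-2 * b)) := by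
    intro ξ
    rw [← lintegral_add_right_eq_self _ (‖ξ‖ ^ 2)]
    refine lintegral_congr fun τ => ?_
    simp only [parabWeight, Prod.fst_sub, Prod.snd_sub]
    congr 4 <;> ring
  rw [Measure.volume_eq_prod, lintegral_prod _ (by fun_prop)]
  simp_rw [e1]
  rw [lintegral_lintegral_swap (by fun_prop), mul_comm C]
  rw [← lintegral_mul_const' _ _ hC]
  refine lintegral_mono fun τ => ?_
  rw [lintegral_mul_const' _ _ ENNReal.ofReal_ne_top, mul_comm]
  gcongr
  exact h _ _

instance : (volume : Measure (Rn 2 × ℝ)).IsAddHaarMeasure :=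
  inferInstanceAs (((volume : Measure (Rn 2)).prod (volume : Measure ℝ)).IsAddHaarMeasure)

/-- The triple product in convolution form. -/
def tripleConv (f g h : Rn 2 × ℝ → ENNReal) (ζ : Rn 2 × ℝ) : ENNReal :=
  ∫⁻ q, ∫⁻ p, f (ζ - q - p) * g p * h q

lemma tripleConv_swap_left (f g h : Rn 2 × ℝ → ENNReal) (ζ : Rn 2 × ℝ) :
    tripleConv f g h ζ = tripleConv g f h ζ := by
  unfold tripleConv
  refine lintegral_congr fun q => ?_
  rw [← lintegral_sub_left_eq_self _ (ζ - q)]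
  refine lintegral_congr fun p => ?_
  rw [sub_sub_cancel, mul_comm (f p)]

lemma tripleConv_swap_right {f g h : Rn 2 × ℝ → ENNReal} (hf : Measurable f) (hg : Measurable g)
    (hh : Measurable h) (ζ : Rn 2 × ℝ) : tripleConv f g h ζ = tripleConv f h g ζ := by
  unfold tripleConv
  rw [lintegral_lintegral_swap (by fun_prop)]
  refine lintegral_congr fun p => lintegral_congr fun q => ?_
  rw [sub_right_comm, mul_right_comm]

/-- The weight `⟨ξ⟩^{-4s} ⟨τ - |ξ|²⟩^{-2b}`. -/
def decayWeight (s b : ℝ) (p : Rn 2 × ℝ) : ENNReal :=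
  ENNReal.ofReal (jap p.1 ^ (-(4 * s))) * parabWeight b p

lemma measurable_decayWeight (s b : ℝ) : Measurable (decayWeight s b) := by
  unfold decayWeight
  have := (continuous_jap (n := 2)).measurable
  have := measurable_parabWeight b
  fun_prop

lemma lintegral_decayWeight_ne_top {s b : ℝ} (hs : 1 / 2 < s) (hb : 1 / 2 < b) :
    ∫⁻ p, decayWeight s b p ≠ ⊤ := by
  rw [Measure.volume_eq_prod, lintegral_prod _ (measurable_decayWeight s b).aemeasurable]
  simp only [decayWeight]
  have e : ∀ ξ : Rn 2, ∫⁻ τ : ℝ, ENNReal.ofReal (jap ξ ^ (-(4 * s))) * parabWeight b (ξ, τ) =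
      ENNReal.ofReal (jap ξ ^ (-(4 * s))) * ∫⁻ τ : ℝ, ENNReal.ofReal (japR τ ^ (-2 * b)) := by
    intro ξ
    rw [lintegral_const_mul' _ _ ENNReal.ofReal_ne_top, lintegral_parabWeight_fiber]
  simp_rw [e]
  rw [lintegral_mul_const' _ _ (lintegral_japR_rpow_ne_top hb)]
  refine ENNReal.mul_ne_top (integrable_jap_rpow ?_).lintegral_lt_top.ne
    (lintegral_japR_rpow_ne_top hb)
  push_cast
  linarith

lemma exists_tripleConv_weight_le {s b : ℝ} (hs : 1 / 2 < s) (hb : 1 / 2 < b) :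
    ∃ C : ENNReal, C ≠ ⊤ ∧ ∀ ζ : Rn 2 × ℝ,
      tripleConv (parabWeight b) (parabWeight b) (decayWeight s b) ζ ≤ C := by
  obtain ⟨C, hC, h⟩ := exists_parabWeight_convolution_le hb
  refine ⟨C * ∫⁻ p, decayWeight s b p,
    ENNReal.mul_ne_top hC (lintegral_decayWeight_ne_top hs hb), fun ζ => ?_⟩
  rw [tripleConv, ← lintegral_const_mul' _ _ hC]
  refine lintegral_mono fun q => ?_
  have := measurable_parabWeight b
  simp only
  rw [lintegral_mul_const _ (by fun_prop)]
  gcongr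
  exact h _

lemma sq_lintegral_le_of_sq_le_mul {α : Type*} [MeasurableSpace α] {μ : Measure α}
    {f a c : α → ENNReal} (ha : AEMeasurable a μ) (hc : AEMeasurable c μ)
    (h : ∀ x, f x ^ 2 ≤ a x * c x) :
    (∫⁻ x, f x ∂μ) ^ 2 ≤ (∫⁻ x, a x ∂μ) * ∫⁻ x, c x ∂μ := by
  have h1 : ∀ x, f x ≤ a x ^ (1 / 2 : ℝ) * c x ^ (1 / 2 : ℝ) := by
    intro x
    rw [← ENNReal.mul_rpow_of_nonneg _ _ (by norm_num : (0:ℝ) ≤ 1 / 2), one_div,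
      ENNReal.le_rpow_inv_iff two_pos]
    simpa using h x
  have h2 : ∫⁻ x, f x ∂μ ≤ (∫⁻ x, a x ∂μ) ^ (1 / 2 : ℝ) * (∫⁻ x, c x ∂μ) ^ (1 / 2 : ℝ) :=
    (lintegral_mono h1).trans (ENNReal.lintegral_mul_norm_pow_le ha hc (by norm_num)
      (by norm_num) (by norm_num))
  calc (∫⁻ x, f x ∂μ) ^ 2
      ≤ ((∫⁻ x, a x ∂μ) ^ (1 / 2 : ℝ) * (∫⁻ x, c x ∂μ) ^ (1 / 2 : ℝ)) ^ 2 := by gcongr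
    _ = _ := by
      rw [mul_pow, ← ENNReal.rpow_mul_natCast, ← ENNReal.rpow_mul_natCast]
      norm_num

section Plancherel

variable {V : Type*} [NormedAddCommGroup V] [InnerProductSpace ℝ V] [FiniteDimensional ℝ V]
  [MeasurableSpace V] [BorelSpace V]

open scoped SchwartzMap

lemma integral_fourierInv_mul_eq_of_integrable {h : V → ℂ} (h1 : Integrable h) (g : 𝓢(V, ℂ)) :
    ∫ x, 𝓕⁻ h x * g x = ∫ x, h x * 𝓕⁻ g x := by
  have := VectorFourier.integral_fourierIntegral_smul_eq_flip (μ := volume) (ν := volume)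
    (L := -innerₗ V) (e := Real.fourierChar) (f := h) (g := g) Real.continuous_fourierChar
    (by simp; fun_prop) h1 g.integrable
  simpa [VectorFourier.fourierIntegral, SchwartzMap.fourierInv_coe, Real.fourierInv_eq,
    real_inner_comm] using this

lemma continuous_fourierInv_of_integrable {h : V → ℂ} (h1 : Integrable h) :
    Continuous (𝓕⁻ h) :=
  VectorFourier.fourierIntegral_continuous Real.continuous_fourierChar
    (by simp; fun_prop) h1

lemma lintegral_fourierInv_sq_eq {h : V → ℂ} (h1 : Integrable h) (h2 : MemLp h 2) :
    ∫⁻ x, ‖𝓕⁻ h x‖ₑ ^ 2 = ∫⁻ x, ‖h x‖ₑ ^ 2 := by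
  have key : 𝓕⁻ h =ᵐ[volume] (𝓕⁻ (h2.toLp h) : Lp ℂ 2 (volume : Measure V)) := by
    refine ae_eq_of_integral_contDiff_smul_eq ?_ ?_ fun g g1 g2 => ?_
    · exact (continuous_fourierInv_of_integrable h1).locallyIntegrable
    · exact (Lp.memLp _).locallyIntegrable one_le_two
    have gc : HasCompactSupport (fun x => (g x : ℂ)) := g2.comp_left (g := Complex.ofReal) rfl
    have gd : ContDiff ℝ (⊤ : ℕ∞) (fun x => (g x : ℂ)) :=
      Complex.ofRealCLM.contDiff.comp g1
    have := congrArg (fun T => T (gc.toSchwartzMap gd))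
      (MeasureTheory.Lp.fourierInv_toTemperedDistribution_eq (h2.toLp h))
    simp only [TemperedDistribution.fourierInv_apply, Lp.toTemperedDistribution_apply] at this
    simp only [Complex.real_smul]
    have e1 := integral_fourierInv_mul_eq_of_integrable h1 (gc.toSchwartzMap gd)
    have e2 : ∫ x, h x * 𝓕⁻ (gc.toSchwartzMap gd) x =
        ∫ x, 𝓕⁻ (gc.toSchwartzMap gd) x • (h2.toLp h) x := by
      refine integral_congr_ae ?_
      filter_upwards [h2.coeFn_toLp] with x hx
      rw [hx, smul_eq_mul, mul_comm]
    rw [← e2, ← e1] at this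
    simpa [mul_comm] using this
  have e : ∀ f : V → ℂ, ∫⁻ x, ‖f x‖ₑ ^ 2 = eLpNorm f 2 volume ^ 2 := by
    intro f
    simpa using (eLpNorm_nnreal_pow_eq_lintegral (μ := volume) (f := f) (p := 2) two_ne_zero).symm
  rw [e, e, eLpNorm_congr_ae key, ← eLpNorm_congr_ae h2.coeFn_toLp, ← Lp.enorm_def, ← Lp.enorm_def]
  congr 1
  have e3 : 𝓕 (𝓕⁻ (h2.toLp h) : Lp ℂ 2 (volume : Measure V)) = h2.toLp h :=
    FourierTransform.fourier_fourierInv_eq _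
  have : ‖(𝓕⁻ (h2.toLp h) : Lp ℂ 2 (volume : Measure V))‖ = ‖h2.toLp h‖ := by
    rw [← Lp.norm_fourier_eq, e3]
  rw [← ofReal_norm, ← ofReal_norm, this]

/-- The Fourier transform of a product is the convolution of the Fourier transforms. -/
lemma fourier_mul_eq_convolution (f g : 𝓢(V, ℂ)) (ξ : V) :
    𝓕 (fun x => f x * g x) ξ = ∫ η, 𝓕 f (ξ - η) * 𝓕 g η := by
  set B := ContinuousLinearMap.mul ℂ ℂ
  have h : SchwartzMap.convolution B (𝓕⁻ f) (𝓕⁻ g) = 𝓕⁻ (SchwartzMap.pairing B f g) := by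
    simp [SchwartzMap.convolution]
  have e1 : 𝓕 (fun x => f x * g x) ξ = 𝓕⁻ (SchwartzMap.pairing B f g) (-ξ) := by
    rw [SchwartzMap.fourierInv_coe, Real.fourierInv_eq_fourier_neg, neg_neg]
    rfl
  rw [e1, ← h, SchwartzMap.convolution_apply, convolution_eq_swap,
    ← integral_neg_eq_self]
  refine integral_congr_ae (.of_forall fun η => ?_)
  simp only [SchwartzMap.fourierInv_coe, Real.fourierInv_eq_fourier_neg, SchwartzMap.fourier_coe]
  simp [B, sub_eq_add_neg, add_comm]

lemma enorm_fourier_mul_mul_le (f g h : 𝓢(V, ℂ)) (ξ : V) :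
    ‖𝓕 (fun x => f x * g x * h x) ξ‖ₑ ≤
      ∫⁻ η, ∫⁻ θ, ‖𝓕 f (ξ - η - θ)‖ₑ * ‖𝓕 g θ‖ₑ * ‖𝓕 h η‖ₑ := by
  have e1 : 𝓕 (fun x => f x * g x * h x) ξ = ∫ η, 𝓕 (fun x => f x * g x) (ξ - η) * 𝓕 h η :=
    fourier_mul_eq_convolution (SchwartzMap.pairing (ContinuousLinearMap.mul ℂ ℂ) f g) h ξ
  rw [e1]
  refine (enorm_integral_le_lintegral_enorm _).trans (lintegral_mono fun η => ?_)
  simp only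
  rw [enorm_mul, fourier_mul_eq_convolution, lintegral_mul_const' _ _ enorm_ne_top]
  gcongr
  refine (enorm_integral_le_lintegral_enorm _).trans (lintegral_mono fun θ => ?_)
  simp only [enorm_mul, le_refl]

end Plancherel

lemma IsAdmissibleMultiplier.eventuallyEq_comp_smul {n : ℕ} {s : ℝ} {m₁ : Rn n → ℝ}
    (hm : IsAdmissibleMultiplier n s m₁) {l : ℝ} (hl : 1 ≤ l) {x : Rn n} (hx : 2 < ‖x‖) :
    (fun y => m₁ (l • y)) =ᶠ[nhds x] fun y => (l ^ (-(1 - s))) • m₁ y := by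
  have h0 : ∀ᶠ y in nhds x, 2 < ‖y‖ := continuous_norm.continuousAt.eventually (lt_mem_nhds hx)
  filter_upwards [h0] with y hy
  have hl0 : 0 < l := by linarith
  have h1 : ‖l • y‖ = l * ‖y‖ := by rw [norm_smul, Real.norm_of_nonneg hl0.le]
  rw [hm.2.2.2.2.2 _ hy.le, hm.2.2.2.2.2 (l • y) (by rw [h1]; nlinarith), h1,
    Real.mul_rpow hl0.le (norm_nonneg _), smul_eq_mul]

lemma IsAdmissibleMultiplier.hasTemperateGrowth {n : ℕ} {s : ℝ} (hs : s < 1) {m₁ : Rn n → ℝ}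
    (hm : IsAdmissibleMultiplier n s m₁) : m₁.HasTemperateGrowth := by
  refine ⟨hm.1, fun k => ?_⟩
  have hc : Continuous (iteratedFDeriv ℝ k m₁) := hm.1.continuous_iteratedFDeriv (by exact_mod_cast le_top)
  obtain ⟨C, hC⟩ := (isCompact_closedBall (0 : Rn n) 3).exists_bound_of_continuousOn
    hc.continuousOn
  have hmk : ContDiff ℝ k m₁ := hm.1.of_le (by exact_mod_cast le_top)
  refine ⟨0, C, fun y => ?_⟩
  rw [pow_zero, mul_one]
  by_cases hy : ‖y‖ ≤ 3
  · exact hC y (by simpa using hy)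
  push Not at hy
  set l := ‖y‖ / 3 with hl
  have hl1 : 1 ≤ l := by rw [hl]; linarith
  have hl0 : 0 < l := by linarith
  set x := l⁻¹ • y with hx
  have hyx : y = l • x := by rw [hx, smul_inv_smul₀ hl0.ne']
  have hxn : ‖x‖ = 3 := by
    rw [hx, norm_smul, norm_inv, Real.norm_of_nonneg hl0.le, hl]
    have : ‖y‖ ≠ 0 := by linarith
    field_simp
  have e1 := (hm.eventuallyEq_comp_smul hl1 (x := x) (by linarith)).iteratedFDeriv ℝ k
  have e2 := e1.eq_of_nhds
  rw [iteratedFDeriv_comp_const_smul _ hmk, iteratedFDeriv_const_smul_apply' hmk.contDiffAt] at e2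
  have e3 := congrArg norm e2
  simp only [norm_smul, norm_pow, Real.norm_of_nonneg hl0.le] at e3
  rw [Real.norm_of_nonneg (Real.rpow_nonneg hl0.le _), ← hyx] at e3
  have h1 : 1 ≤ l ^ k := one_le_pow₀ hl1
  have h2 : l ^ (-(1 - s)) ≤ 1 := Real.rpow_le_one_of_one_le_of_nonpos hl1 (by linarith)
  have h3 := hC x (by simp [hxn])
  calc ‖iteratedFDeriv ℝ k m₁ y‖ ≤ l ^ k * ‖iteratedFDeriv ℝ k m₁ y‖ :=
        le_mul_of_one_le_left (norm_nonneg _) h1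
    _ = _ := e3
    _ ≤ 1 * ‖iteratedFDeriv ℝ k m₁ x‖ := by gcongr
    _ ≤ C := by rwa [one_mul]

lemma IsAdmissibleMultiplier.hasTemperateGrowth_mN {n : ℕ} {s : ℝ} (hs : s < 1) {m₁ : Rn n → ℝ}
    (hm : IsAdmissibleMultiplier n s m₁) (N : ℝ) :
    (fun ξ => (mN m₁ N ξ : ℂ)).HasTemperateGrowth :=
  Function.Complex.hasTemperateGrowth_ofReal.comp ((hm.hasTemperateGrowth hs).comp
    (N⁻¹ • ContinuousLinearMap.id ℝ (Rn n)).hasTemperateGrowth)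

section Weight

variable {s : ℝ} {m₁ : Rn 2 → ℝ} {N : ℝ}

lemma norm_le_jap {n : ℕ} (ξ : Rn n) : ‖ξ‖ ≤ jap ξ :=
  Real.le_sqrt_of_sq_le (by linarith)

lemma jap_le_one_add_norm {n : ℕ} (ξ : Rn n) : jap ξ ≤ 1 + ‖ξ‖ :=
  Real.sqrt_le_iff.2 ⟨by positivity, by nlinarith [norm_nonneg ξ]⟩

lemma jap_le_jap {n : ℕ} {ξ η : Rn n} (h : ‖ξ‖ ≤ ‖η‖) : jap ξ ≤ jap η := by
  unfold jap; gcongr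

lemma jap_le_three_mul_jap {n : ℕ} {ξ η : Rn n} (h : ‖ξ‖ ≤ 3 * ‖η‖) : jap ξ ≤ 3 * jap η := by
  refine Real.sqrt_le_iff.2 ⟨by have := one_le_jap η; positivity, ?_⟩
  rw [mul_pow, jap, Real.sq_sqrt (by positivity)]
  nlinarith [norm_nonneg ξ, norm_nonneg η]

lemma norm_inv_smul_of_one_le {n : ℕ} (hN : 1 ≤ N) (ξ : Rn n) : ‖N⁻¹ • ξ‖ = ‖ξ‖ / N := by
  rw [norm_smul, norm_inv, Real.norm_of_nonneg (by linarith)]; ring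

lemma IsAdmissibleMultiplier.half_le (hs0 : 0 < s)
    (hm : IsAdmissibleMultiplier 2 s m₁) {ξ : Rn 2} (h : ‖ξ‖ ≤ 2) : 1 / 2 ≤ m₁ ξ := by
  have h2 : ‖(EuclideanSpace.single 0 2 : Rn 2)‖ = 2 := by simp
  calc (1 / 2 : ℝ) = 2 ^ (-1 : ℝ) := by rw [Real.rpow_neg_one]; norm_num
    _ ≤ 2 ^ (-(1 - s)) := Real.rpow_le_rpow_of_exponent_le (by norm_num) (by linarith)
    _ = m₁ (EuclideanSpace.single 0 2) := by rw [hm.2.2.2.2.2 _ h2.ge, h2]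
    _ ≤ m₁ ξ := hm.2.2.2.1 _ _ (by rwa [h2])

/-- The weight `⟨ξ⟩ m_N(ξ)` is essentially nondecreasing. -/
lemma IsAdmissibleMultiplier.jap_mul_mN_le (hs0 : 0 < s) (hs1 : s < 1)
    (hm : IsAdmissibleMultiplier 2 s m₁) (hN : 1 ≤ N) {ξ η : Rn 2} (h : ‖ξ‖ ≤ 3 * ‖η‖) :
    jap ξ * mN m₁ N ξ ≤ 3 * (jap η * mN m₁ N η) := by
  have hN0 : 0 < N := by linarith
  have jξ := one_le_jap ξ
  have jη := one_le_jap η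
  have nξ := norm_inv_smul_of_one_le hN ξ
  have nη := norm_inv_smul_of_one_le hN η
  unfold mN
  have pξ := hm.2.1 (N⁻¹ • ξ)
  have pη := hm.2.1 (N⁻¹ • η)
  rcases le_total ‖η‖ ‖ξ‖ with h1 | h1
  · have h2 : m₁ (N⁻¹ • ξ) ≤ m₁ (N⁻¹ • η) := hm.2.2.2.1 _ _ (by rw [nξ, nη]; gcongr)
    calc jap ξ * m₁ (N⁻¹ • ξ) ≤ (3 * jap η) * m₁ (N⁻¹ • η) := by
          gcongr
          · exact pξ.1.le
          · exact jap_le_three_mul_jap h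
      _ = _ := by ring
  have h3 := jap_le_jap h1
  rcases le_total ‖N⁻¹ • η‖ 2 with h4 | h4
  · have := hm.half_le hs0 h4
    nlinarith [mul_le_mul_of_nonneg_left pξ.2 (by linarith : 0 ≤ jap ξ),
      mul_le_mul_of_nonneg_left this (by linarith : 0 ≤ jap η)]
  have hη0 : 0 < ‖η‖ := by
    rw [nη, le_div_iff₀ hN0] at h4
    linarith
  rcases le_total ‖N⁻¹ • ξ‖ 2 with h5 | h5
  · have h6 : N / ‖η‖ ≤ m₁ (N⁻¹ • η) := by
      rw [hm.2.2.2.2.2 _ h4]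
      calc N / ‖η‖ = ‖N⁻¹ • η‖ ^ (-1 : ℝ) := by rw [nη, Real.rpow_neg_one, inv_div]
        _ ≤ _ := Real.rpow_le_rpow_of_exponent_le (by linarith) (by linarith)
    have h7 : N ≤ jap η * m₁ (N⁻¹ • η) := calc
      N = ‖η‖ * (N / ‖η‖) := by field_simp
      _ ≤ _ := by
        gcongr
        exact norm_le_jap η
    rw [nξ, div_le_iff₀ hN0] at h5
    nlinarith [jap_le_one_add_norm ξ,
      mul_le_mul_of_nonneg_left pξ.2 (by linarith : 0 ≤ jap ξ)]
  · have h8 : ‖ξ‖ ≤ ‖N⁻¹ • ξ‖ * N := by rw [nξ]; field_simp; rfl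
    have h9 : 2 ≤ ‖ξ‖ := by rw [nξ, le_div_iff₀ hN0] at h5; linarith
    have hr : 1 ≤ ‖η‖ / ‖ξ‖ := by rw [one_le_div (by linarith)]; exact h1
    have h6 : m₁ (N⁻¹ • ξ) ≤ ‖η‖ / ‖ξ‖ * m₁ (N⁻¹ • η) := by
      have e : ‖N⁻¹ • η‖ = ‖η‖ / ‖ξ‖ * ‖N⁻¹ • ξ‖ := by rw [nξ, nη]; field_simp
      rw [hm.2.2.2.2.2 _ h4, hm.2.2.2.2.2 _ h5, e, Real.mul_rpow (by positivity) (by positivity),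
        ← mul_assoc]
      refine le_mul_of_one_le_left (by positivity) ?_
      nth_rw 1 [← Real.rpow_one (‖η‖ / ‖ξ‖)]
      rw [← Real.rpow_add (by linarith)]
      exact Real.one_le_rpow hr (by linarith)
    calc jap ξ * m₁ (N⁻¹ • ξ) ≤ (2 * ‖ξ‖) * (‖η‖ / ‖ξ‖ * m₁ (N⁻¹ • η)) := by
          gcongr
          · exact pξ.1.le
          · linarith [jap_le_one_add_norm ξ]
      _ = 2 * (‖η‖ * m₁ (N⁻¹ • η)) := by
          have : ‖ξ‖ ≠ 0 := by linarith
          field_simp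
      _ ≤ 3 * (jap η * m₁ (N⁻¹ • η)) := by
          have : ‖η‖ * m₁ (N⁻¹ • η) ≤ jap η * m₁ (N⁻¹ • η) :=
            mul_le_mul_of_nonneg_right (norm_le_jap η) pη.1.le
          have : 0 ≤ jap η * m₁ (N⁻¹ • η) := mul_nonneg (by linarith) pη.1.le
          linarith

lemma IsAdmissibleMultiplier.one_le_jap_rpow_mul (hs0 : 0 < s) (hs1 : s < 1)
    (hm : IsAdmissibleMultiplier 2 s m₁) (hN : 1 ≤ N) (ξ : Rn 2) :
    1 ≤ 4 * jap ξ ^ (-(2 * s)) * (jap ξ * mN m₁ N ξ) ^ 2 := by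
  have jξ := one_le_jap ξ
  have j0 : 0 < jap ξ := by linarith
  have h1 : m₁ ξ ≤ mN m₁ N ξ := hm.2.2.2.1 _ _ (by
    rw [norm_inv_smul_of_one_le hN]; exact div_le_self (norm_nonneg _) hN)
  have h2 : 1 / 2 * jap ξ ^ (-(1 - s)) ≤ m₁ ξ := by
    rcases le_total ‖ξ‖ 2 with h | h
    · have := hm.half_le hs0 h
      have h3 : jap ξ ^ (-(1 - s)) ≤ 1 :=
        Real.rpow_le_one_of_one_le_of_nonpos jξ (by linarith)
      linarith
    · rw [hm.2.2.2.2.2 _ h]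
      have h3 : jap ξ ^ (-(1 - s)) ≤ ‖ξ‖ ^ (-(1 - s)) :=
        Real.rpow_le_rpow_of_nonpos (by linarith) (norm_le_jap ξ) (by linarith)
      have : 0 ≤ jap ξ ^ (-(1 - s)) := by positivity
      linarith
  have e : jap ξ ^ s = jap ξ * jap ξ ^ (-(1 - s)) := by
    nth_rw 2 [← Real.rpow_one (jap ξ)]
    rw [← Real.rpow_add j0]
    ring_nf
  have h4 : 1 / 2 * jap ξ ^ s ≤ jap ξ * mN m₁ N ξ := by
    rw [e]
    calc 1 / 2 * (jap ξ * jap ξ ^ (-(1 - s))) = jap ξ * (1 / 2 * jap ξ ^ (-(1 - s))) := by ring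
      _ ≤ _ := mul_le_mul_of_nonneg_left (h2.trans h1) j0.le
  have h5 : jap ξ ^ (-(2 * s)) * (jap ξ ^ s) ^ 2 = 1 := by
    rw [← Real.rpow_mul_natCast j0.le, ← Real.rpow_add j0]
    norm_num
    ring_nf
    simp
  calc (1:ℝ) = 4 * jap ξ ^ (-(2 * s)) * (1 / 2 * jap ξ ^ s) ^ 2 := by
        linear_combination -h5
    _ ≤ _ := by gcongr

lemma IsAdmissibleMultiplier.weight_sq_le (hs0 : 0 < s) (hs1 : s < 1)
    (hm : IsAdmissibleMultiplier 2 s m₁) (hN : 1 ≤ N) (ξ₁ ξ₂ ξ₃ : Rn 2) :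
    (jap (ξ₁ + ξ₂ + ξ₃) * mN m₁ N (ξ₁ + ξ₂ + ξ₃)) ^ 2 ≤
      144 * ((jap ξ₁ * mN m₁ N ξ₁) ^ 2 * (jap ξ₂ * mN m₁ N ξ₂) ^ 2 *
        (jap ξ₃ * mN m₁ N ξ₃) ^ 2) *
        (jap ξ₁ ^ (-(4 * s)) + jap ξ₂ ^ (-(4 * s)) + jap ξ₃ ^ (-(4 * s))) := by
  have w0 : ∀ ξ : Rn 2, 0 ≤ jap ξ * mN m₁ N ξ := fun ξ =>
    mul_nonneg (by linarith [one_le_jap ξ]) (hm.2.1 _).1.le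
  have hmax : ∃ η ∈ ({ξ₁, ξ₂, ξ₃} : Finset (Rn 2)), ∀ ζ ∈ ({ξ₁, ξ₂, ξ₃} : Finset (Rn 2)),
      ‖ζ‖ ≤ ‖η‖ := Finset.exists_max_image _ _ (by simp)
  have hsum : (jap (ξ₁ + ξ₂ + ξ₃) * mN m₁ N (ξ₁ + ξ₂ + ξ₃)) ^ 2 ≤
      9 * ((jap ξ₁ * mN m₁ N ξ₁) ^ 2 + (jap ξ₂ * mN m₁ N ξ₂) ^ 2 +
        (jap ξ₃ * mN m₁ N ξ₃) ^ 2) := by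
    obtain ⟨η, hη, hle⟩ := hmax
    simp only [Finset.mem_insert, Finset.mem_singleton, forall_eq_or_imp, forall_eq] at hη hle
    have h1 : ‖ξ₁ + ξ₂ + ξ₃‖ ≤ 3 * ‖η‖ := by linarith [norm_add₃_le (a := ξ₁) (b := ξ₂) (c := ξ₃)]
    have h2 := pow_le_pow_left₀ (w0 _) (hm.jap_mul_mN_le hs0 hs1 hN h1) 2
    rw [mul_pow] at h2
    have := sq_nonneg (jap ξ₁ * mN m₁ N ξ₁)
    have := sq_nonneg (jap ξ₂ * mN m₁ N ξ₂)
    have := sq_nonneg (jap ξ₃ * mN m₁ N ξ₃)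
    rcases hη with rfl | rfl | rfl <;> linarith
  have hp : ∀ ξ : Rn 2, jap ξ ^ (-(4 * s)) = (jap ξ ^ (-(2 * s))) ^ 2 := by
    intro ξ
    rw [← Real.rpow_mul_natCast (by linarith [one_le_jap ξ])]
    norm_num
    ring_nf
  rw [hp, hp, hp]
  have q1 := hm.one_le_jap_rpow_mul hs0 hs1 hN ξ₁
  have q2 := hm.one_le_jap_rpow_mul hs0 hs1 hN ξ₂
  have q3 := hm.one_le_jap_rpow_mul hs0 hs1 hN ξ₃
  have key : ∀ a b c p q : ℝ, 0 ≤ a → 0 ≤ b → 0 ≤ c → 1 ≤ 4 * p * b → 1 ≤ 4 * q * c →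
      a ≤ 8 * (a * b * c) * (p ^ 2 + q ^ 2) := by
    intro a b c p q ha hb hc h1 h2
    have h3 : 1 ≤ (4 * p * b) * (4 * q * c) := one_le_mul_of_one_le_of_one_le h1 h2
    have h4 : 0 ≤ a * b * c * (p - q) ^ 2 := by positivity
    nlinarith [mul_le_mul_of_nonneg_left h3 ha]
  have k1 := key _ _ _ _ _ (sq_nonneg (jap ξ₁ * mN m₁ N ξ₁)) (sq_nonneg _) (sq_nonneg _) q2 q3
  have k2 := key _ _ _ _ _ (sq_nonneg (jap ξ₂ * mN m₁ N ξ₂)) (sq_nonneg _) (sq_nonneg _) q1 q3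
  have k3 := key _ _ _ _ _ (sq_nonneg (jap ξ₃ * mN m₁ N ξ₃)) (sq_nonneg _) (sq_nonneg _) q1 q2
  linarith

end Weight

/-- The Fourier-side weight `(⟨ξ⟩ m_N(ξ))² ⟨τ - |ξ|²⟩^{2b}`. -/
def energyWeight (m₁ : Rn 2 → ℝ) (N b : ℝ) (p : Rn 2 × ℝ) : ENNReal :=
  ENNReal.ofReal ((jap p.1 * mN m₁ N p.1) ^ 2 * japR (p.2 - ‖p.1‖ ^ 2) ^ (2 * b))

lemma IsAdmissibleMultiplier.continuous_mN {n : ℕ} {s : ℝ} {m₁ : Rn n → ℝ}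
    (hm : IsAdmissibleMultiplier n s m₁) (N : ℝ) : Continuous (mN m₁ N) :=
  hm.1.continuous.comp (continuous_const_smul _)

lemma measurable_energyWeight {s : ℝ} {m₁ : Rn 2 → ℝ} (hm : IsAdmissibleMultiplier 2 s m₁)
    (N b : ℝ) : Measurable (energyWeight m₁ N b) := by
  unfold energyWeight
  have := (continuous_jap (n := 2)).measurable
  have := continuous_japR.measurable
  have := (hm.continuous_mN N).measurable
  fun_prop

lemma energyWeight_mul_parabWeight (m₁ : Rn 2 → ℝ) (N b : ℝ) (p : Rn 2 × ℝ) :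
    energyWeight m₁ N b p * parabWeight b p =
      ENNReal.ofReal ((jap p.1 * mN m₁ N p.1) ^ 2) := by
  have h : 0 < japR (p.2 - ‖p.1‖ ^ 2) := zero_lt_one.trans_le (one_le_japR _)
  rw [energyWeight, parabWeight, ← ENNReal.ofReal_mul (by positivity), mul_assoc,
    ← Real.rpow_add h]
  simp

lemma lintegral_tripleConv {f g h : Rn 2 × ℝ → ENNReal} (hf : Measurable f) (hg : Measurable g)
    (hh : Measurable h) :
    ∫⁻ ζ, tripleConv f g h ζ = (∫⁻ p, f p) * (∫⁻ p, g p) * ∫⁻ p, h p := by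
  unfold tripleConv
  rw [lintegral_lintegral_swap]
  · have e : ∀ q, ∫⁻ ζ, ∫⁻ p, f (ζ - q - p) * g p * h q = (∫⁻ p, f p) * (∫⁻ p, g p) * h q := by
      intro q
      rw [lintegral_lintegral_swap (by fun_prop)]
      have e' : ∀ p, ∫⁻ ζ, f (ζ - q - p) * g p * h q = (∫⁻ p, f p) * (g p * h q) := by
        intro p
        simp_rw [mul_assoc]
        rw [lintegral_mul_const _ (by fun_prop)]
        simp_rw [sub_sub]
        rw [lintegral_sub_right_eq_self f]
      simp_rw [e']
      rw [lintegral_const_mul _ (by fun_prop), lintegral_mul_const _ hg, mul_assoc]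
    simp_rw [e]
    rw [lintegral_const_mul _ hh]
  · refine Measurable.aemeasurable ?_
    refine Measurable.lintegral_prod_right' (f := fun z : ((Rn 2 × ℝ) × (Rn 2 × ℝ)) × (Rn 2 × ℝ) =>
      f (z.1.1 - z.1.2 - z.2) * g z.2 * h z.1.2) ?_
    fun_prop

lemma IsAdmissibleMultiplier.sq_le_energyWeight {s b : ℝ} {m₁ : Rn 2 → ℝ} {N : ℝ}
    (hs0 : 0 < s) (hs1 : s < 1)
    (hm : IsAdmissibleMultiplier 2 s m₁) (hN : 1 ≤ N) (x y z : Rn 2 × ℝ) :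
    ENNReal.ofReal (jap (x + y + z).1 * mN m₁ N (x + y + z).1) ^ 2 ≤
      energyWeight m₁ N b x * energyWeight m₁ N b y * energyWeight m₁ N b z *
        (144 * (decayWeight s b x * parabWeight b y * parabWeight b z +
          parabWeight b x * decayWeight s b y * parabWeight b z +
          parabWeight b x * parabWeight b y * decayWeight s b z)) := by
  have hp : ∀ ξ : Rn 2, 0 < jap ξ := fun ξ => zero_lt_one.trans_le (one_le_jap ξ)
  have hw : ∀ ξ, 0 ≤ mN m₁ N ξ := fun ξ => (hm.2.1 _).1.le
  have h := hm.weight_sq_le hs0 hs1 hN x.1 y.1 z.1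
  have e : energyWeight m₁ N b x * energyWeight m₁ N b y * energyWeight m₁ N b z *
        (144 * (decayWeight s b x * parabWeight b y * parabWeight b z +
          parabWeight b x * decayWeight s b y * parabWeight b z +
          parabWeight b x * parabWeight b y * decayWeight s b z)) =
      144 * ((energyWeight m₁ N b x * parabWeight b x) * (energyWeight m₁ N b y * parabWeight b y) *
        (energyWeight m₁ N b z * parabWeight b z)) * (ENNReal.ofReal (jap x.1 ^ (-(4 * s))) +
        ENNReal.ofReal (jap y.1 ^ (-(4 * s))) + ENNReal.ofReal (jap z.1 ^ (-(4 * s)))) := by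
    simp only [decayWeight]
    ring
  rw [e]
  simp only [energyWeight_mul_parabWeight]
  have h144 : (144 : ENNReal) = ENNReal.ofReal 144 := by norm_num
  have hj := fun ξ : Rn 2 => Real.rpow_nonneg (hp ξ).le (-(4 * s))
  rw [← ENNReal.ofReal_add (hj _) (hj _), ← ENNReal.ofReal_add (add_nonneg (hj _) (hj _)) (hj _),
    ← ENNReal.ofReal_mul (by positivity), ← ENNReal.ofReal_mul (by positivity), h144,
    ← ENNReal.ofReal_mul (by positivity), ← ENNReal.ofReal_mul (by positivity),
    ← ENNReal.ofReal_pow (mul_nonneg (hp _).le (hw _))]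
  refine ENNReal.ofReal_le_ofReal (h.trans_eq ?_)
  ring

/-- The trilinear `L²` estimate on the Fourier side. -/
lemma exists_trilinear_le {s b : ℝ} (hs : 1 / 2 < s) (hs1 : s < 1) (hb : 1 / 2 < b) :
    ∃ K : ENNReal, K ≠ ⊤ ∧ ∀ m₁ : Rn 2 → ℝ, IsAdmissibleMultiplier 2 s m₁ → ∀ N : ℝ, 1 ≤ N →
      ∀ f g h : Rn 2 × ℝ → ENNReal, Measurable f → Measurable g → Measurable h →
      ∫⁻ ζ, (ENNReal.ofReal (jap ζ.1 * mN m₁ N ζ.1) * tripleConv f g h ζ) ^ 2 ≤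
        K * ((∫⁻ p, energyWeight m₁ N b p * f p ^ 2) * (∫⁻ p, energyWeight m₁ N b p * g p ^ 2) *
          ∫⁻ p, energyWeight m₁ N b p * h p ^ 2) := by
  obtain ⟨C, hC, hCb⟩ := exists_tripleConv_weight_le hs hb
  refine ⟨144 * (C + C + C), by finiteness, ?_⟩
  intro m₁ hm N hN f g h hf hg hh
  have he := measurable_energyWeight hm N b
  have hu := measurable_parabWeight b
  have hd := measurable_decayWeight s b
  have := (continuous_jap (n := 2)).measurable
  have := (hm.continuous_mN N).measurable
  set E := energyWeight m₁ N b
  set u := parabWeight b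
  set d := decayWeight s b
  have hker : ∀ ζ, ∫⁻ q, ∫⁻ p, 144 * (d (ζ - q - p) * u p * u q + u (ζ - q - p) * d p * u q +
      u (ζ - q - p) * u p * d q) ≤ 144 * (C + C + C) := by
    intro ζ
    have e1 : ∀ q, ∫⁻ p, 144 * (d (ζ - q - p) * u p * u q + u (ζ - q - p) * d p * u q +
        u (ζ - q - p) * u p * d q) = 144 * ((∫⁻ p, d (ζ - q - p) * u p * u q) +
          (∫⁻ p, u (ζ - q - p) * d p * u q) + ∫⁻ p, u (ζ - q - p) * u p * d q) := by
      intro q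
      rw [lintegral_const_mul _ (by fun_prop), lintegral_add_left (by fun_prop),
        lintegral_add_left (by fun_prop)]
    have hme : ∀ f g h : Rn 2 × ℝ → ENNReal, Measurable f → Measurable g → Measurable h →
        Measurable fun q => ∫⁻ p, f (ζ - q - p) * g p * h q := by
      intro f g h hf hg hh
      refine Measurable.lintegral_prod_right' (f := fun z : (Rn 2 × ℝ) × (Rn 2 × ℝ) =>
        f (ζ - z.1 - z.2) * g z.2 * h z.1) ?_
      fun_prop
    have m1 := hme d u u hd hu hu
    have m2 := hme u d u hu hd hu
    have m3 := hme u u d hu hu hd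
    simp_rw [e1]
    rw [lintegral_const_mul _ (by fun_prop), lintegral_add_left (by fun_prop),
      lintegral_add_left (by fun_prop)]
    change 144 * (tripleConv d u u ζ + tripleConv u d u ζ + tripleConv u u d ζ) ≤ _
    rw [tripleConv_swap_left d u u, tripleConv_swap_right hu hd hu]
    gcongr <;> exact hCb ζ
  have hpt : ∀ ζ, (ENNReal.ofReal (jap ζ.1 * mN m₁ N ζ.1) * tripleConv f g h ζ) ^ 2 ≤
      tripleConv (fun p => E p * f p ^ 2) (fun p => E p * g p ^ 2) (fun p => E p * h p ^ 2) ζ *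
        (144 * (C + C + C)) := by
    intro ζ
    refine le_trans ?_ (mul_le_mul_right (hker ζ) _)
    unfold tripleConv
    rw [← lintegral_const_mul' _ _ ENNReal.ofReal_ne_top]
    simp_rw [← lintegral_const_mul' _ _ ENNReal.ofReal_ne_top]
    rw [lintegral_lintegral (by fun_prop), lintegral_lintegral (by fun_prop),
      lintegral_lintegral (by fun_prop)]
    refine sq_lintegral_le_of_sq_le_mul (by fun_prop) (by fun_prop) ?_
    rintro ⟨q, p⟩
    have := hm.sq_le_energyWeight (b := b) (by linarith) hs1 hN (ζ - q - p) p q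
    rw [sub_add_cancel, sub_add_cancel] at this
    simp only
    calc _ = ENNReal.ofReal (jap ζ.1 * mN m₁ N ζ.1) ^ 2 *
          (f (ζ - q - p) * g p * h q) ^ 2 := by ring
      _ ≤ _ := mul_le_mul_left this _
      _ = _ := by ring
  refine (lintegral_mono hpt).trans_eq ?_
  rw [lintegral_mul_const' _ _ (by finiteness), lintegral_tripleConv (by fun_prop) (by fun_prop)
    (by fun_prop), mul_comm]

section Slices

open SchwartzMap WithLp

variable {U W : Type*} [NormedAddCommGroup U] [InnerProductSpace ℝ U]
  [NormedAddCommGroup W] [InnerProductSpace ℝ W]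

/-- The restriction of a Schwartz function to the slice with second coordinate `t`. -/
def sliceFst (f : 𝓢(WithLp 2 (U × W), ℂ)) (t : W) : 𝓢(U, ℂ) :=
  SchwartzMap.compCLMOfAntilipschitz ℂ (K := 1) (g := fun x : U => toLp 2 (x, t))
    (by
      have : (fun x : U => toLp 2 (x, t)) = fun x : U =>
          ((WithLp.prodContinuousLinearEquiv 2 ℝ U W).symm.toContinuousLinearMap.comp
            (ContinuousLinearMap.inl ℝ U W)) x + toLp 2 (0, t) := by
        ext1 x
        simp [← WithLp.toLp_add]
      rw [this]
      fun_prop)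
    (AntilipschitzWith.of_le_mul_dist fun x y => by
      rw [dist_eq_norm, dist_eq_norm, ← WithLp.toLp_sub, WithLp.prod_norm_eq_of_L2]
      simp) f

/-- The restriction of a Schwartz function to the slice with first coordinate `ξ`. -/
def sliceSnd (f : 𝓢(WithLp 2 (U × W), ℂ)) (ξ : U) : 𝓢(W, ℂ) :=
  SchwartzMap.compCLMOfAntilipschitz ℂ (K := 1) (g := fun τ : W => toLp 2 (ξ, τ))
    (by
      have : (fun τ : W => toLp 2 (ξ, τ)) = fun τ : W =>
          ((WithLp.prodContinuousLinearEquiv 2 ℝ U W).symm.toContinuousLinearMap.comp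
            (ContinuousLinearMap.inr ℝ U W)) τ + toLp 2 (ξ, 0) := by
        ext1 x
        simp [← WithLp.toLp_add]
      rw [this]
      fun_prop)
    (AntilipschitzWith.of_le_mul_dist fun x y => by
      rw [dist_eq_norm, dist_eq_norm, ← WithLp.toLp_sub, WithLp.prod_norm_eq_of_L2]
      simp) f

lemma SchwartzMap.exists_one_add_norm_pow_mul_le {E : Type*} [NormedAddCommGroup E]
    [NormedSpace ℝ E] (f : 𝓢(E, ℂ)) (k : ℕ) :
    ∃ C : ℝ, 0 ≤ C ∧ ∀ v, (1 + ‖v‖) ^ k * ‖f v‖ ≤ C := by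
  have h := SchwartzMap.one_add_le_sup_seminorm_apply (𝕜 := ℝ) (m := (k, 0)) (k := k) (n := 0)
    le_rfl le_rfl f
  simp only [norm_iteratedFDeriv_zero] at h
  exact ⟨_, (by positivity : (0:ℝ) ≤ (1 + ‖(0:E)‖) ^ k * ‖f 0‖).trans (h 0), h⟩

variable [FiniteDimensional ℝ U] [MeasurableSpace U] [BorelSpace U]

lemma continuous_fourier_sliceFst (f : 𝓢(WithLp 2 (U × W), ℂ)) (ξ : U) :
    Continuous fun t => 𝓕 (fun x => f (toLp 2 (x, t))) ξ := by
  simp only [Real.fourier_eq]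
  obtain ⟨C, hC0, hC⟩ := f.exists_one_add_norm_pow_mul_le (Module.finrank ℝ U + 1)
  refine continuous_of_dominated (bound := fun x : U =>
    C * (1 + ‖x‖) ^ (-(Module.finrank ℝ U + 1 : ℕ) : ℝ)) ?_ ?_ ?_ ?_
  · intro t
    refine Continuous.aestronglyMeasurable ?_
    have := f.continuous
    have := Real.continuous_fourierChar
    fun_prop
  · intro t
    refine .of_forall fun x => ?_
    rw [Circle.norm_smul, Real.rpow_neg (by positivity), Real.rpow_natCast, ← div_eq_mul_inv,
      le_div_iff₀ (by positivity), mul_comm]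
    refine le_trans ?_ (hC (toLp 2 (x, t)))
    gcongr
    rw [WithLp.prod_norm_eq_of_L2]
    exact Real.le_sqrt_of_sq_le (by simp)
  · refine (integrable_one_add_norm ?_).const_mul C
    push_cast
    linarith
  · refine .of_forall fun x => ?_
    have := f.continuous
    fun_prop

variable [FiniteDimensional ℝ W] [MeasurableSpace W] [BorelSpace W]

lemma Integrable.comp_toLp {F : WithLp 2 (U × W) → ℂ} (hF : Integrable F) :
    Integrable (fun p : U × W => F (toLp 2 p)) :=
  (WithLp.volume_preserving_toLp U W).integrable_comp_of_integrable hF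

lemma integral_withLp (F : WithLp 2 (U × W) → ℂ) :
    ∫ v, F v = ∫ p : U × W, F (toLp 2 p) :=
  ((WithLp.volume_preserving_toLp U W).integral_comp
    (MeasurableEquiv.toLp 2 (U × W)).measurableEmbedding F).symm

lemma fourier_toLp_eq_fourier_fourier {F : WithLp 2 (U × W) → ℂ} (hF : Integrable F)
    (ξ : U) (τ : W) :
    𝓕 F (toLp 2 (ξ, τ)) = 𝓕 (fun t => 𝓕 (fun x => F (toLp 2 (x, t))) ξ) τ := by
  rw [Real.fourier_eq, integral_withLp, Measure.volume_eq_prod, integral_prod_symm]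
  · rw [Real.fourier_eq]
    refine integral_congr_ae (.of_forall fun t => ?_)
    simp only [Real.fourier_eq, Circle.smul_def, smul_eq_mul, ← integral_const_mul]
    refine integral_congr_ae (.of_forall fun x => ?_)
    simp only [WithLp.prod_inner_apply, ← mul_assoc, ← Circle.coe_mul, ← AddChar.map_add_eq_mul]
    congr 3
    ring
  · rw [← Measure.volume_eq_prod]
    refine Integrable.comp_toLp (F := fun v => Real.fourierChar (-inner ℝ v (toLp 2 (ξ, τ))) • F v) ?_
    exact (Real.fourierIntegral_convergent_iff _).2 hF

lemma fourierInv_toLp_eq_fourierInv_fourierInv {F : WithLp 2 (U × W) → ℂ} (hF : Integrable F)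
    (x : U) (t : W) :
    𝓕⁻ F (toLp 2 (x, t)) = 𝓕⁻ (fun ξ => 𝓕⁻ (fun τ => F (toLp 2 (ξ, τ))) t) x := by
  rw [Real.fourierInv_eq, integral_withLp, Measure.volume_eq_prod, integral_prod]
  · rw [Real.fourierInv_eq]
    refine integral_congr_ae (.of_forall fun ξ => ?_)
    simp only [Real.fourierInv_eq, Circle.smul_def, smul_eq_mul, ← integral_const_mul]
    refine integral_congr_ae (.of_forall fun τ => ?_)
    simp only [WithLp.prod_inner_apply, ← mul_assoc, ← Circle.coe_mul, ← AddChar.map_add_eq_mul]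
  · rw [← Measure.volume_eq_prod]
    refine Integrable.comp_toLp (F := fun v => Real.fourierChar (inner ℝ v (toLp 2 (x, t))) • F v) ?_
    simpa using (Real.fourierIntegral_convergent_iff (-(toLp 2 (x, t)))).2 hF

lemma fourier_sliceFst (f : 𝓢(WithLp 2 (U × W), ℂ)) (ξ : U) (t : W) :
    𝓕 (fun x => f (toLp 2 (x, t))) ξ = 𝓕⁻ (fun τ => 𝓕 f (toLp 2 (ξ, τ))) t := by
  set g : W → ℂ := fun t => 𝓕 (fun x => f (toLp 2 (x, t))) ξ with hg
  have e : 𝓕 g = fun τ => 𝓕 f (toLp 2 (ξ, τ)) := by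
    funext τ
    rw [SchwartzMap.fourier_coe, fourier_toLp_eq_fourier_fourier f.integrable]
  have i1 : Integrable g := by
    have h := Integrable.comp_toLp
      ((Real.fourierIntegral_convergent_iff (toLp 2 (ξ, (0 : W)))).2 f.integrable)
    rw [Measure.volume_eq_prod] at h
    refine h.integral_prod_right.congr (.of_forall fun t => ?_)
    simp [hg, Real.fourier_eq, WithLp.prod_inner_apply]
  have i2 : Integrable (𝓕 g) := by
    rw [e]
    exact (sliceSnd (𝓕 f) ξ).integrable
  rw [← e, (continuous_fourier_sliceFst f ξ).fourierInv_fourier_eq i1 i2]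

end Slices

section SpaceTime

open SchwartzMap WithLp

/-- The Fourier multiplier with symbol `m` acting in the first variable. -/
def fstMultiplier {n : ℕ} (m : Rn n → ℂ) (f : 𝓢(WithLp 2 (Rn n × ℝ), ℂ)) :
    𝓢(WithLp 2 (Rn n × ℝ), ℂ) :=
  𝓕⁻ (smulLeftCLM ℂ (fun v : WithLp 2 (Rn n × ℝ) => m v.fst) (𝓕 f))

lemma fourier_fstMultiplier {n : ℕ} {m : Rn n → ℂ} (hm : m.HasTemperateGrowth)
    (f : 𝓢(WithLp 2 (Rn n × ℝ), ℂ)) (v : WithLp 2 (Rn n × ℝ)) :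
    𝓕 (fstMultiplier m f) v = m v.fst * 𝓕 f v := by
  have h : (fun v : WithLp 2 (Rn n × ℝ) => m v.fst).HasTemperateGrowth :=
    hm.comp ((ContinuousLinearMap.fst ℝ (Rn n) ℝ).comp
      (WithLp.prodContinuousLinearEquiv 2 ℝ (Rn n) ℝ).toContinuousLinearMap).hasTemperateGrowth
  rw [fstMultiplier, FourierTransform.fourier_fourierInv_eq, smulLeftCLM_apply_apply h,
    smul_eq_mul]

lemma fourierInv_const_mul {V : Type*} [NormedAddCommGroup V] [InnerProductSpace ℝ V]
    [FiniteDimensional ℝ V] [MeasurableSpace V] [BorelSpace V] (c : ℂ) (h : V → ℂ) (x : V) :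
    𝓕⁻ (fun v => c * h v) x = c * 𝓕⁻ h x := by
  simp only [Real.fourierInv_eq, Circle.smul_def, smul_eq_mul, ← integral_const_mul]
  refine integral_congr_ae (.of_forall fun v => ?_)
  simp only
  ring

lemma Iop_slice {n : ℕ} {m₁ : Rn n → ℝ} {N : ℝ}
    (hm : (fun ξ => (mN m₁ N ξ : ℂ)).HasTemperateGrowth) (f : 𝓢(WithLp 2 (Rn n × ℝ), ℂ))
    (x : Rn n) (t : ℝ) :
    Iop m₁ N (fun y => f (toLp 2 (y, t))) x =
      fstMultiplier (fun ξ => (mN m₁ N ξ : ℂ)) f (toLp 2 (x, t)) := by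
  set g := fstMultiplier (fun ξ => (mN m₁ N ξ : ℂ)) f
  have e : (fun ξ => (mN m₁ N ξ : ℂ) * 𝓕 (fun y => f (toLp 2 (y, t))) ξ) =
      𝓕 (sliceFst g t) := by
    funext ξ
    rw [SchwartzMap.fourier_coe]
    change _ = 𝓕 (fun x => g (toLp 2 (x, t))) ξ
    rw [fourier_sliceFst, fourier_sliceFst, ← fourierInv_const_mul]
    simp only [g, fourier_fstMultiplier hm, WithLp.toLp_fst]
  rw [Iop, e, ← SchwartzMap.fourierInv_coe, FourierTransform.fourierInv_fourier_eq]
  rfl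

lemma stFourier_eq_fourier {n : ℕ} (f : 𝓢(WithLp 2 (Rn n × ℝ), ℂ)) (ξ : Rn n) (τ : ℝ) :
    stFourier n (fun x t => f (toLp 2 (x, t))) ξ τ = 𝓕 f (toLp 2 (ξ, τ)) := by
  have hF := Integrable.comp_toLp
    ((Real.fourierIntegral_convergent_iff (toLp 2 (ξ, τ))).2 f.integrable)
  rw [Measure.volume_eq_prod] at hF
  rw [SchwartzMap.fourier_coe, Real.fourier_eq, integral_withLp, Measure.volume_eq_prod,
    integral_prod _ hF, stFourier]
  refine integral_congr_ae (.of_forall fun x => integral_congr_ae (.of_forall fun t => ?_))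
  simp only [WithLp.prod_inner_apply, Circle.smul_def, Real.fourierChar_apply, smul_eq_mul]
  congr 2
  simp
  ring

lemma LP_slice {n : ℕ} (M : ℝ) (f : 𝓢(WithLp 2 (Rn n × ℝ), ℂ)) (x : Rn n) (t : ℝ) :
    LP n M (fun y => f (toLp 2 (y, t))) x =
      𝓕⁻ ({v : WithLp 2 (Rn n × ℝ) | M ≤ jap v.fst ∧ jap v.fst ≤ 2 * M}.indicator
        (𝓕 f : 𝓢(WithLp 2 (Rn n × ℝ), ℂ))) (toLp 2 (x, t)) := by
  have hA : MeasurableSet {v : WithLp 2 (Rn n × ℝ) | M ≤ jap v.fst ∧ jap v.fst ≤ 2 * M} := by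
    have h : Continuous fun v : WithLp 2 (Rn n × ℝ) => jap v.fst :=
      continuous_jap.comp (by fun_prop)
    exact (measurableSet_le measurable_const h.measurable).inter
      (measurableSet_le h.measurable measurable_const)
  rw [fourierInv_toLp_eq_fourierInv_fourierInv ((𝓕 f).integrable.indicator hA), LP]
  refine congrFun (congrArg _ ?_) x
  funext ξ
  rw [fourier_sliceFst]
  by_cases h : M ≤ jap ξ ∧ jap ξ ≤ 2 * M
  · simp [indicator, h]
  · simp [indicator, h, Real.fourierInv_eq]

lemma lintegral_withLp {n : ℕ} (F : WithLp 2 (Rn n × ℝ) → ENNReal) :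
    ∫⁻ v, F v = ∫⁻ p : Rn n × ℝ, F (toLp 2 p) :=
  ((WithLp.volume_preserving_toLp (Rn n) ℝ).lintegral_comp_emb
    (MeasurableEquiv.toLp 2 (Rn n × ℝ)).measurableEmbedding F).symm

lemma ofReal_lpNormST_sq_le {n : ℕ} {H : WithLp 2 (Rn n × ℝ) → ℂ} (hH : Continuous H) :
    ENNReal.ofReal (lpNormST n 2 (fun x t => H (toLp 2 (x, t))) ^ 2) ≤ ∫⁻ v, ‖H v‖ₑ ^ 2 := by
  have h0 : 0 ≤ ∫ t : ℝ, ∫ x : Rn n, ‖H (toLp 2 (x, t))‖ ^ (2 : ℝ) :=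
    integral_nonneg fun t => integral_nonneg fun x => by positivity
  rw [lpNormST, ← Real.rpow_natCast, ← Real.rpow_mul h0]
  norm_num
  have e : ∫⁻ v, ‖H v‖ₑ ^ 2 = ∫⁻ t : ℝ, ∫⁻ x : Rn n, ‖H (toLp 2 (x, t))‖ₑ ^ 2 := by
    rw [lintegral_withLp, Measure.volume_eq_prod, lintegral_prod_symm _ (by fun_prop)]
  have h0' : 0 ≤ ∫ t : ℝ, ∫ x : Rn n, ‖H (toLp 2 (x, t))‖ ^ 2 :=
    integral_nonneg fun t => integral_nonneg fun x => by positivity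
  rw [e, ← Real.enorm_of_nonneg h0']
  refine (enorm_integral_le_lintegral_enorm _).trans (lintegral_mono fun t => ?_)
  refine (enorm_integral_le_lintegral_enorm _).trans_eq (lintegral_congr fun x => ?_)
  rw [enorm_pow, enorm_norm]

lemma ofReal_lpNormST_LP_sq_le {n : ℕ} (M : ℝ) (f : 𝓢(WithLp 2 (Rn n × ℝ), ℂ)) :
    ENNReal.ofReal (lpNormST n 2 (fun x t => LP n M (fun y => f (toLp 2 (y, t))) x) ^ 2) ≤
      ∫⁻ p in {p : Rn n × ℝ | M ≤ jap p.1 ∧ jap p.1 ≤ 2 * M}, ‖𝓕 f (toLp 2 p)‖ₑ ^ 2 := by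
  have hA : MeasurableSet {v : WithLp 2 (Rn n × ℝ) | M ≤ jap v.fst ∧ jap v.fst ≤ 2 * M} := by
    have h : Continuous fun v : WithLp 2 (Rn n × ℝ) => jap v.fst :=
      continuous_jap.comp (by fun_prop)
    exact (measurableSet_le measurable_const h.measurable).inter
      (measurableSet_le h.measurable measurable_const)
  have hA' : MeasurableSet {p : Rn n × ℝ | M ≤ jap p.1 ∧ jap p.1 ≤ 2 * M} :=
    (WithLp.measurable_toLp 2 (Rn n × ℝ)) hA
  simp only [LP_slice]
  have i1 := ((𝓕 f).integrable (μ := volume)).indicator hA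
  refine (ofReal_lpNormST_sq_le (continuous_fourierInv_of_integrable i1)).trans_eq ?_
  rw [lintegral_fourierInv_sq_eq i1 (((𝓕 f).memLp 2 (μ := volume)).indicator hA),
    lintegral_withLp, ← lintegral_indicator hA']
  refine lintegral_congr fun p => ?_
  by_cases h : M ≤ jap p.1 ∧ jap p.1 ≤ 2 * M <;> simp [indicator, h]

lemma integrable_weight_mul_norm_sq {n : ℕ} {r b : ℝ} (hr : 0 ≤ r) (hb : 0 ≤ b)
    (f : 𝓢(WithLp 2 (Rn n × ℝ), ℂ)) :
    Integrable fun p : Rn n × ℝ =>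
      jap p.1 ^ r * japR (p.2 - ‖p.1‖ ^ 2) ^ b * ‖f (toLp 2 p)‖ ^ 2 := by
  obtain ⟨k, hk⟩ := exists_nat_ge r
  obtain ⟨l, hl⟩ := exists_nat_ge b
  obtain ⟨C, hC0, hC⟩ := f.exists_one_add_norm_pow_mul_le (k + 2 * l)
  refine Integrable.mono' ((Integrable.comp_toLp f.integrable).norm.const_mul C) ?_
    (.of_forall fun p => ?_)
  · have h1 : Continuous fun p : Rn n × ℝ => jap p.1 ^ r :=
      (continuous_jap.comp continuous_fst).rpow_const fun p => .inr hr
    have h2 : Continuous fun p : Rn n × ℝ => japR (p.2 - ‖p.1‖ ^ 2) ^ b :=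
      (continuous_japR.comp (by fun_prop)).rpow_const fun p => .inr hb
    have h3 := f.continuous
    exact Continuous.aestronglyMeasurable (by fun_prop)
  · have hj1 := one_le_jap p.1
    have hj2 := one_le_japR (p.2 - ‖p.1‖ ^ 2)
    have n1 : ‖p.1‖ ≤ ‖toLp 2 p‖ := by
      rw [WithLp.prod_norm_eq_of_L2]
      exact Real.le_sqrt_of_sq_le (by simp; positivity)
    have n2 : |p.2| ≤ ‖toLp 2 p‖ := by
      rw [WithLp.prod_norm_eq_of_L2]
      exact Real.le_sqrt_of_sq_le (by simp)
    set R := ‖toLp 2 p‖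
    have hR : 0 ≤ R := norm_nonneg _
    have b1 : jap p.1 ^ r ≤ (1 + R) ^ k := by
      calc jap p.1 ^ r ≤ jap p.1 ^ (k : ℝ) := Real.rpow_le_rpow_of_exponent_le hj1 hk
        _ = jap p.1 ^ k := Real.rpow_natCast _ _
        _ ≤ _ := by
          gcongr
          exact (jap_le_one_add_norm _).trans (by linarith)
    have b2 : japR (p.2 - ‖p.1‖ ^ 2) ≤ (1 + R) ^ 2 := by
      refine Real.sqrt_le_iff.2 ⟨by positivity, ?_⟩
      have ha := abs_le.1 n2
      have h1 : ‖p.1‖ ^ 2 ≤ R ^ 2 := by gcongr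
      have h2 : |p.2 - ‖p.1‖ ^ 2| ≤ R + R ^ 2 :=
        abs_le.2 ⟨by linarith, by nlinarith [sq_nonneg ‖p.1‖]⟩
      have h3 := sq_le_sq' (by linarith [abs_nonneg (p.2 - ‖p.1‖ ^ 2), sq_nonneg R]) h2
      rw [sq_abs] at h3
      nlinarith [pow_nonneg hR 3, sq_nonneg R]
    have b3 : japR (p.2 - ‖p.1‖ ^ 2) ^ b ≤ (1 + R) ^ (2 * l) := by
      calc japR (p.2 - ‖p.1‖ ^ 2) ^ b ≤ japR (p.2 - ‖p.1‖ ^ 2) ^ (l : ℝ) :=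
            Real.rpow_le_rpow_of_exponent_le hj2 hl
        _ = japR (p.2 - ‖p.1‖ ^ 2) ^ l := Real.rpow_natCast _ _
        _ ≤ ((1 + R) ^ 2) ^ l := by gcongr
        _ = _ := by rw [pow_mul]
    rw [Real.norm_of_nonneg (by positivity)]
    calc _ ≤ (1 + R) ^ k * (1 + R) ^ (2 * l) * ‖f (toLp 2 p)‖ ^ 2 := by gcongr
      _ = ((1 + R) ^ (k + 2 * l) * ‖f (toLp 2 p)‖) * ‖f (toLp 2 p)‖ := by ring
      _ ≤ _ := by gcongr; exact hC _

lemma XNorm_nonneg {n : ℕ} (s b : ℝ) (ψ : Rn n → ℝ → ℂ) : 0 ≤ XNorm n s b ψ := by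
  refine Real.rpow_nonneg (integral_nonneg fun ξ => integral_nonneg fun τ => ?_) _
  have := one_le_jap ξ
  have := one_le_japR (τ - ‖ξ‖ ^ 2)
  simp only
  positivity

lemma ofReal_XNorm_sq {n : ℕ} {s b : ℝ} (hs : 0 ≤ s) (hb : 0 ≤ b)
    (f : 𝓢(WithLp 2 (Rn n × ℝ), ℂ)) :
    ENNReal.ofReal (XNorm n s b (fun x t => f (toLp 2 (x, t))) ^ 2) =
      ∫⁻ p : Rn n × ℝ, ENNReal.ofReal
        (jap p.1 ^ (2 * s) * japR (p.2 - ‖p.1‖ ^ 2) ^ (2 * b) * ‖𝓕 f (toLp 2 p)‖ ^ 2) := by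
  have hi := integrable_weight_mul_norm_sq (r := 2 * s) (b := 2 * b) (by positivity)
    (by positivity) (𝓕 f)
  have hn : ∀ p : Rn n × ℝ, 0 ≤
      jap p.1 ^ (2 * s) * japR (p.2 - ‖p.1‖ ^ 2) ^ (2 * b) * ‖𝓕 f (toLp 2 p)‖ ^ 2 := by
    intro p
    have := one_le_jap p.1
    have := one_le_japR (p.2 - ‖p.1‖ ^ 2)
    positivity
  rw [← ofReal_integral_eq_lintegral_ofReal hi (.of_forall hn)]
  rw [Measure.volume_eq_prod] at hi
  simp only [XNorm, stFourier_eq_fourier]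
  rw [Measure.volume_eq_prod, ← integral_prod _ hi, ← Measure.volume_eq_prod,
    ← Real.rpow_natCast, ← Real.rpow_mul (integral_nonneg hn)]
  norm_num

lemma IsAdmissibleMultiplier.ofReal_XNorm_Iop_sq {s : ℝ} {m₁ : Rn 2 → ℝ} (hs : s < 1)
    (hm : IsAdmissibleMultiplier 2 s m₁) (N : ℝ) {b : ℝ} (hb : 0 ≤ b)
    (f : 𝓢(WithLp 2 (Rn 2 × ℝ), ℂ)) :
    ENNReal.ofReal (XNorm 2 1 b (fun x t => Iop m₁ N (fun y => f (toLp 2 (y, t))) x) ^ 2) =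
      ∫⁻ p, energyWeight m₁ N b p * ‖𝓕 f (toLp 2 p)‖ₑ ^ 2 := by
  have hg := hm.hasTemperateGrowth_mN hs N
  simp only [Iop_slice hg]
  rw [ofReal_XNorm_sq zero_le_one hb]
  refine lintegral_congr fun p => ?_
  have := one_le_japR (p.2 - ‖p.1‖ ^ 2)
  rw [fourier_fstMultiplier hg, energyWeight, ← ofReal_norm, ← ENNReal.ofReal_pow (norm_nonneg _),
    ← ENNReal.ofReal_mul (by positivity)]
  congr 1
  rw [norm_mul, Complex.norm_real, WithLp.toLp_fst, mul_pow, Real.norm_eq_abs, sq_abs, mul_one,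
    Real.rpow_two]
  ring

lemma one_le_inv_japR_sq_mul_jap_sq {n : ℕ} {M : ℝ} (hM : 0 ≤ M) {ξ : Rn n} (h : M ≤ jap ξ) :
    1 ≤ 2 * (japR M)⁻¹ ^ 2 * jap ξ ^ 2 := by
  have h1 := one_le_jap ξ
  have h2 : japR M ^ 2 = 1 + M ^ 2 := Real.sq_sqrt (by positivity)
  rw [inv_pow, h2, mul_right_comm, ← div_eq_mul_inv, le_div_iff₀ (by positivity)]
  nlinarith

/-- The squared form of the localized cubic estimate. -/
lemma exists_lpNormST_cubic_sq_le {s b : ℝ} (hs : 1 / 2 < s) (hs1 : s < 1) (hb : 1 / 2 < b) :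
    ∃ K : ℝ, 0 ≤ K ∧ ∀ m₁ : Rn 2 → ℝ, IsAdmissibleMultiplier 2 s m₁ → ∀ N : ℝ, 1 ≤ N →
      ∀ M : ℝ, 0 ≤ M → ∀ f g h : 𝓢(WithLp 2 (Rn 2 × ℝ), ℂ),
      lpNormST 2 2 (fun x t => LP 2 M
        (Iop m₁ N (fun y => f (toLp 2 (y, t)) * g (toLp 2 (y, t)) * h (toLp 2 (y, t)))) x) ^ 2 ≤
        K * (japR M)⁻¹ ^ 2 *
          (XNorm 2 1 b (fun x t => Iop m₁ N (fun y => f (toLp 2 (y, t))) x) ^ 2 *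
          XNorm 2 1 b (fun x t => Iop m₁ N (fun y => g (toLp 2 (y, t))) x) ^ 2 *
          XNorm 2 1 b (fun x t => Iop m₁ N (fun y => h (toLp 2 (y, t))) x) ^ 2) := by
  obtain ⟨K, hK, hKb⟩ := exists_trilinear_le hs hs1 hb
  refine ⟨2 * K.toReal, by positivity, fun m₁ hm N hN M hM f g h => ?_⟩
  have hg := hm.hasTemperateGrowth_mN hs1 N
  have hb0 : 0 ≤ b := by linarith
  set P : 𝓢(WithLp 2 (Rn 2 × ℝ), ℂ) := SchwartzMap.pairing (ContinuousLinearMap.mul ℂ ℂ)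
    (SchwartzMap.pairing (ContinuousLinearMap.mul ℂ ℂ) f g) h with hP
  have e : ∀ t, (fun y => f (toLp 2 (y, t)) * g (toLp 2 (y, t)) * h (toLp 2 (y, t))) =
      fun y => P (toLp 2 (y, t)) := fun t => rfl
  have e2 : ∀ t, Iop m₁ N (fun y => P (toLp 2 (y, t))) =
      fun y => fstMultiplier (fun ξ => (mN m₁ N ξ : ℂ)) P (toLp 2 (y, t)) :=
    fun t => funext fun x => Iop_slice hg P x t
  simp only [e, e2]
  rw [← ENNReal.ofReal_le_ofReal_iff (by positivity)]
  refine (ofReal_lpNormST_LP_sq_le M _).trans ?_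
  set F := fun p : Rn 2 × ℝ => ‖𝓕 f (toLp 2 p)‖ₑ
  set G := fun p : Rn 2 × ℝ => ‖𝓕 g (toLp 2 p)‖ₑ
  set H := fun p : Rn 2 × ℝ => ‖𝓕 h (toLp 2 p)‖ₑ
  have hmeas : ∀ f : 𝓢(WithLp 2 (Rn 2 × ℝ), ℂ), Measurable fun p : Rn 2 × ℝ =>
      ‖𝓕 f (toLp 2 p)‖ₑ := by
    intro f
    exact ((𝓕 f).continuous.measurable.comp (WithLp.measurable_toLp 2 _)).enorm
  have hconv : ∀ p : Rn 2 × ℝ, ‖𝓕 P (toLp 2 p)‖ₑ ≤ tripleConv F G H p := by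
    intro p
    refine (enorm_fourier_mul_mul_le f g h (toLp 2 p)).trans_eq ?_
    simp only [lintegral_withLp]
    rfl
  have hpt : ∀ p : Rn 2 × ℝ, M ≤ jap p.1 →
      ‖𝓕 (fstMultiplier (fun ξ => (mN m₁ N ξ : ℂ)) P) (toLp 2 p)‖ₑ ^ 2 ≤
        ENNReal.ofReal (2 * (japR M)⁻¹ ^ 2) *
          (ENNReal.ofReal (jap p.1 * mN m₁ N p.1) * tripleConv F G H p) ^ 2 := by
    intro p hp
    have hm0 : 0 ≤ mN m₁ N p.1 := (hm.2.1 _).1.le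
    have hj := one_le_jap p.1
    rw [fourier_fstMultiplier hg, enorm_mul, WithLp.toLp_fst, mul_pow, mul_pow, ← mul_assoc,
      ← ENNReal.ofReal_pow (by positivity), ← ENNReal.ofReal_mul (by positivity), ← ofReal_norm,
      Complex.norm_real, Real.norm_of_nonneg hm0, ← ENNReal.ofReal_pow hm0]
    gcongr
    · have := mul_le_mul_of_nonneg_right (one_le_inv_japR_sq_mul_jap_sq hM hp) (sq_nonneg (mN m₁ N p.1))
      nlinarith
    · exact hconv p
  calc _ ≤ ∫⁻ p in {p : Rn 2 × ℝ | M ≤ jap p.1 ∧ jap p.1 ≤ 2 * M},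
        ENNReal.ofReal (2 * (japR M)⁻¹ ^ 2) *
          (ENNReal.ofReal (jap p.1 * mN m₁ N p.1) * tripleConv F G H p) ^ 2 := by
        refine setLIntegral_mono' ?_ fun p hp => hpt p hp.1
        have h : Continuous fun p : Rn 2 × ℝ => jap p.1 := continuous_jap.comp continuous_fst
        exact (measurableSet_le measurable_const h.measurable).inter
          (measurableSet_le h.measurable measurable_const)
    _ ≤ ∫⁻ p, ENNReal.ofReal (2 * (japR M)⁻¹ ^ 2) *
          (ENNReal.ofReal (jap p.1 * mN m₁ N p.1) * tripleConv F G H p) ^ 2 :=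
        setLIntegral_le_lintegral _ _
    _ ≤ ENNReal.ofReal (2 * (japR M)⁻¹ ^ 2) * (ENNReal.ofReal K.toReal * _) := by
        rw [lintegral_const_mul' _ _ ENNReal.ofReal_ne_top, ENNReal.ofReal_toReal hK]
        gcongr
        exact hKb m₁ hm N hN F G H (hmeas f) (hmeas g) (hmeas h)
    _ = _ := by
        rw [← hm.ofReal_XNorm_Iop_sq hs1 N hb0, ← hm.ofReal_XNorm_Iop_sq hs1 N hb0,
          ← hm.ofReal_XNorm_Iop_sq hs1 N hb0, ← ENNReal.ofReal_mul (by positivity),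
          ← ENNReal.ofReal_mul (by positivity), ← ENNReal.ofReal_mul (by positivity),
          ← ENNReal.ofReal_mul (by positivity)]
        congr 1
        ring

end SpaceTime

/-- Localized L² bound for a cubic product in ℝ^{2+1}. -/
theorem statement_12 :
    ∀ s : ℝ, 4/7 < s → s < 1 →
    ∀ m₁ : Rn 2 → ℝ, IsAdmissibleMultiplier 2 s m₁ →
    ∃ ε₀ > (0:ℝ), ∀ ε : ℝ, 0 < ε → ε < ε₀ →
    ∃ C > (0:ℝ),
    ∀ N : ℝ, 1 ≤ N → ∀ kM : ℤ,
    ∀ φ₁ φ₂ φ₃ : SchwartzMap (Rn 2 × ℝ) ℂ,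
    lpNormST 2 2 (fun x t => LP 2 ((2:ℝ) ^ kM)
        (Iop m₁ N (fun y => φ₁ (y, t) * φ₂ (y, t) * φ₃ (y, t))) x)
      ≤ C * (japR ((2:ℝ) ^ kM))⁻¹ *
          XNorm 2 1 (1/2 + ε) (fun x t => Iop m₁ N (fun y => φ₁ (y, t)) x) *
          XNorm 2 1 (1/2 + ε) (fun x t => Iop m₁ N (fun y => φ₂ (y, t)) x) *
          XNorm 2 1 (1/2 + ε) (fun x t => Iop m₁ N (fun y => φ₃ (y, t)) x) := by
  intro s hs hs1 m₁ hm
  refine ⟨1, one_pos, fun ε hε _ => ?_⟩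
  obtain ⟨K, hK, hKb⟩ := exists_lpNormST_cubic_sq_le (s := s) (b := 1 / 2 + ε) (by linarith) hs1
    (by linarith)
  refine ⟨√K + 1, by positivity, fun N hN kM φ₁ φ₂ φ₃ => ?_⟩
  set T := SchwartzMap.compCLMOfContinuousLinearEquiv (F := ℂ) ℂ
    (WithLp.prodContinuousLinearEquiv 2 ℝ (Rn 2) ℝ)
  have h := hKb m₁ hm N hN ((2:ℝ) ^ kM) (by positivity) (T φ₁) (T φ₂) (T φ₃)
  have hT : ∀ (φ : SchwartzMap (Rn 2 × ℝ) ℂ) (p : Rn 2 × ℝ), T φ (WithLp.toLp 2 p) = φ p :=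
    fun φ p => rfl
  simp only [hT] at h
  set X₁ := XNorm 2 1 (1/2 + ε) (fun x t => Iop m₁ N (fun y => φ₁ (y, t)) x)
  set X₂ := XNorm 2 1 (1/2 + ε) (fun x t => Iop m₁ N (fun y => φ₂ (y, t)) x)
  set X₃ := XNorm 2 1 (1/2 + ε) (fun x t => Iop m₁ N (fun y => φ₃ (y, t)) x)
  have h1 : 0 ≤ X₁ := XNorm_nonneg _ _ _
  have h2 : 0 ≤ X₂ := XNorm_nonneg _ _ _
  have h3 : 0 ≤ X₃ := XNorm_nonneg _ _ _
  have hj : 0 ≤ (japR ((2:ℝ) ^ kM))⁻¹ := inv_nonneg.2 (Real.sqrt_nonneg _)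
  set J := (japR ((2:ℝ) ^ kM))⁻¹
  have e : K * J ^ 2 * (X₁ ^ 2 * X₂ ^ 2 * X₃ ^ 2) = (√K * J * X₁ * X₂ * X₃) ^ 2 := by
    simp only [mul_pow, Real.sq_sqrt hK]
    ring
  rw [e] at h
  refine (le_abs_self _).trans ((abs_le_of_sq_le_sq h (by positivity)).trans ?_)
  gcongr
  linarith

end
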